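/- Let f be a nonnegative submodular function on V, and let S₁, S₂, S* ⊆ V with S₁ ∩ S₂ = ∅. Then f(S₁ ∪ S*) + f(S₂ ∪ (S* \ S₁)) + f(S₁ ∩ S*) ≥ f(S*). -/

import Mathlib

theorem nonneg_submodular_three_term_bound
    {V : Type*} [Fintype V] [DecidableEq V] (f : Finset V → ℝ)
    (hnn : ∀ A : Finset V, 0 ≤ f A)
    (hsub : ∀ A B : Finset V, f (A ∪ B) + f (A ∩ B) ≤ f A + f B)
    (S₁ S₂ Sstar : Finset V) (hdisj : Disjoint S₁ S₂) :
    f (S₁ ∪ Sstar) + f (S₂ ∪ (Sstar \ S₁)) + f (S₁ ∩ Sstar) ≥ f Sstar := by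
  have hinter : (S₁ ∪ Sstar) ∩ (S₂ ∪ (Sstar \ S₁)) = Sstar \ S₁ := by
    ext x
    have hx : x ∈ S₁ → x ∉ S₂ := fun h₁ h₂ => Finset.disjoint_left.mp hdisj h₁ h₂
    simp only [Finset.mem_inter, Finset.mem_union, Finset.mem_sdiff]
    tauto
  have hunion : (Sstar \ S₁) ∪ (S₁ ∩ Sstar) = Sstar := by
    rw [Finset.inter_comm, Finset.sdiff_union_inter]
  have hcross := hsub (S₁ ∪ Sstar) (S₂ ∪ (Sstar \ S₁))
  have hsplit := hsub (Sstar \ S₁) (S₁ ∩ Sstar)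
  rw [hinter] at hcross
  rw [hunion] at hsplit
  linarith [hnn ((S₁ ∪ Sstar) ∪ (S₂ ∪ (Sstar \ S₁))), hnn ((Sstar \ S₁) ∩ (S₁ ∩ Sstar))]
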